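/- Let a ∈ C([0,1]) with a ≥ 0, h ∈ C([0,1]) with h ≥ 0, and c ∈ ℝ. Suppose c + (∫₀¹ σ h(σ)dσ)·exp(−∫₀¹ σ a(σ)dσ) ≥ 0. If τ solves -τ'' + a τ = h, τ(0)=0, τ'(1)=c, then for all s ∈ [0,1]: τ(s) ≥ s·{c + (∫₀¹ σ h dσ)·exp(−∫₀¹ σ a dσ)}·exp(−∫₀¹ σ a dσ) and τ(s) ≤ s·(c + ∫₀¹ h dσ). -/

import Mathlib

open MeasureTheory Set

/-- A function with nonpositive derivative on `[u, v]` does not increase from `u` to `v`. -/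
theorem le_left_of_hasDerivWithinAt_nonpos {f f' : ℝ → ℝ} {u v : ℝ} (huv : u ≤ v)
    (hf : ∀ s ∈ Icc u v, HasDerivWithinAt f (f' s) (Icc u v) s)
    (hf' : ∀ s ∈ Icc u v, f' s ≤ 0) : f v ≤ f u := by
  have hanti : AntitoneOn f (Icc u v) :=
    antitoneOn_of_hasDerivWithinAt_nonpos (convex_Icc u v)
      (fun s hs => (hf s hs).continuousWithinAt)
      (fun s hs => (hf s (interior_subset hs)).mono interior_subset)
      (fun s hs => hf' s (interior_subset hs))
  exact hanti (left_mem_Icc.2 huv) (right_mem_Icc.2 huv) huv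

/-- A function with nonnegative derivative on `[u, v]` does not decrease from `u` to `v`. -/
theorem left_le_of_hasDerivWithinAt_nonneg {f f' : ℝ → ℝ} {u v : ℝ} (huv : u ≤ v)
    (hf : ∀ s ∈ Icc u v, HasDerivWithinAt f (f' s) (Icc u v) s)
    (hf' : ∀ s ∈ Icc u v, 0 ≤ f' s) : f u ≤ f v := by
  have := le_left_of_hasDerivWithinAt_nonpos (f := fun s => -f s) (f' := fun s => -f' s) huv
    (fun s hs => (hf s hs).neg) (fun s hs => neg_nonpos.2 (hf' s hs))
  exact neg_le_neg_iff.1 this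

theorem hasDerivWithinAt_integral_of_continuousOn {f : ℝ → ℝ} {u v : ℝ}
    (hf : ContinuousOn f (Icc u v)) {s : ℝ} (hs : s ∈ Icc u v) :
    HasDerivWithinAt (fun t => ∫ x in u..t, f x) (f s) (Icc u v) s := by
  have : Fact (s ∈ Icc u v) := ⟨hs⟩
  refine intervalIntegral.integral_hasDerivWithinAt_right
    ((hf.mono (Icc_subset_Icc_right hs.2)).intervalIntegrable_of_Icc hs.1) ?_ (hf s hs)
  exact hf.stronglyMeasurableAtFilter_nhdsWithin measurableSet_Icc s

/-- If `f` is concave wherever it is nonpositive, then it is nonnegative between two points at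
which it is nonnegative. -/
theorem nonneg_of_deriv_nonpos_of_nonpos {f f' f'' : ℝ → ℝ} {u v : ℝ}
    (hf : ∀ s ∈ Icc u v, HasDerivWithinAt f (f' s) (Icc u v) s)
    (hf' : ∀ s ∈ Icc u v, HasDerivWithinAt f' (f'' s) (Icc u v) s)
    (hf'' : ∀ s ∈ Icc u v, f s ≤ 0 → f'' s ≤ 0)
    (hu : 0 ≤ f u) (hv : 0 ≤ f v) : ∀ s ∈ Icc u v, 0 ≤ f s := by
  intro x hx
  by_contra! hneg
  have hcont : ContinuousOn f (Icc u v) := fun s hs => (hf s hs).continuousWithinAt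
  have hclosed : IsClosed (Icc u v ∩ f ⁻¹' Ici 0) :=
    hcont.preimage_isClosed_of_isClosed isClosed_Icc isClosed_Ici
  obtain ⟨l, ⟨⟨hl, hfl⟩, hlx⟩, hlmax⟩ :=
    ((isCompact_Icc.of_isClosed_subset hclosed inter_subset_left).inter_right
      (isClosed_Iic (a := x))).exists_isGreatest
      ⟨u, ⟨left_mem_Icc.2 (hx.1.trans hx.2), hu⟩, hx.1⟩
  obtain ⟨r, ⟨⟨hr, hfr⟩, hxr⟩, hrmin⟩ :=
    ((isCompact_Icc.of_isClosed_subset hclosed inter_subset_left).inter_right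
      (isClosed_Ici (a := x))).exists_isLeast
      ⟨v, ⟨right_mem_Icc.2 (hx.1.trans hx.2), hv⟩, hx.2⟩
  simp only [mem_preimage, mem_Ici, mem_Iic] at hfl hfr hlx hxr
  have hlx : l < x := lt_of_le_of_ne hlx (by rintro rfl; linarith)
  have hxr : x < r := lt_of_le_of_ne hxr (by rintro rfl; linarith)
  have hmid : ∀ s ∈ Ioo l r, f s < 0 := by
    intro s hs
    by_contra! hs0
    have hsm : s ∈ Icc u v := ⟨hl.1.trans hs.1.le, hs.2.le.trans hr.2⟩
    rcases le_total s x with h | h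
    · exact absurd (hlmax ⟨⟨hsm, hs0⟩, h⟩) (not_le.2 hs.1)
    · exact absurd (hrmin ⟨⟨hsm, hs0⟩, h⟩) (not_le.2 hs.2)
  have hderiv : ∀ s ∈ Ioo l r, HasDerivAt f (f' s) s := fun s hs =>
    (hf s ⟨hl.1.trans hs.1.le, hs.2.le.trans hr.2⟩).hasDerivAt
      (Icc_mem_nhds (hl.1.trans_lt hs.1) (hs.2.trans_le hr.2))
  obtain ⟨p, hp, hfp⟩ := exists_hasDerivAt_eq_slope f f' hlx
    (hcont.mono (Icc_subset_Icc hl.1 hx.2)) (fun s hs => hderiv s ⟨hs.1, hs.2.trans hxr⟩)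
  obtain ⟨q, hq, hfq⟩ := exists_hasDerivAt_eq_slope f f' hxr
    (hcont.mono (Icc_subset_Icc hx.1 hr.2)) (fun s hs => hderiv s ⟨hlx.trans hs.1, hs.2⟩)
  have hp0 : f' p < 0 := by
    rw [hfp]; exact div_neg_of_neg_of_pos (by linarith) (by linarith)
  have hq0 : 0 < f' q := by
    rw [hfq]; exact div_pos (by linarith) (by linarith)
  have hsub : Icc p q ⊆ Icc u v :=
    Icc_subset_Icc (hl.1.trans hp.1.le) (hq.2.le.trans hr.2)
  have := le_left_of_hasDerivWithinAt_nonpos (hp.2.trans hq.1).le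
    (fun s hs => (hf' s (hsub hs)).mono hsub)
    (fun s hs => hf'' s (hsub hs) (hmid s ⟨hp.1.trans_le hs.1, hs.2.trans_lt hq.2⟩).le)
  linarith

/-- The primitive of `exp (∫₀ˢ σ a)` is a supersolution `χ'' = s a χ' ≥ a χ`, and it lies between
`s` and `s χ'`. -/
theorem exists_supersolution {a : ℝ → ℝ} (ha_cont : ContinuousOn a (Icc 0 1))
    (ha_nonneg : ∀ s ∈ Icc (0:ℝ) 1, 0 ≤ a s) :
    ∃ χ χ' : ℝ → ℝ, χ 0 = 0 ∧ χ' 1 = Real.exp (∫ σ in (0:ℝ)..1, σ * a σ) ∧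
      (∀ s ∈ Icc (0:ℝ) 1, HasDerivWithinAt χ (χ' s) (Icc 0 1) s) ∧
      (∀ s ∈ Icc (0:ℝ) 1, HasDerivWithinAt χ' (s * a s * χ' s) (Icc 0 1) s) ∧
      (∀ s ∈ Icc (0:ℝ) 1, s ≤ χ s) ∧ (∀ s ∈ Icc (0:ℝ) 1, χ s ≤ s * χ' s) ∧
      (∀ s ∈ Icc (0:ℝ) 1, χ' s ≤ χ' 1) := by
  set χ' : ℝ → ℝ := fun s => Real.exp (∫ σ in (0:ℝ)..s, σ * a σ) with hχ'
  have hd' : ∀ s ∈ Icc (0:ℝ) 1, HasDerivWithinAt χ' (s * a s * χ' s) (Icc 0 1) s := by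
    intro s hs
    have := (hasDerivWithinAt_integral_of_continuousOn (f := fun σ => σ * a σ)
      (continuousOn_id.mul ha_cont) hs).exp
    rwa [mul_comm] at this
  have hd : ∀ s ∈ Icc (0:ℝ) 1,
      HasDerivWithinAt (fun t => ∫ x in (0:ℝ)..t, χ' x) (χ' s) (Icc 0 1) s := fun s hs =>
    hasDerivWithinAt_integral_of_continuousOn (fun t ht => (hd' t ht).continuousWithinAt) hs
  have hpos : ∀ s, 0 < χ' s := fun s => Real.exp_pos _
  have hnn : ∀ s ∈ Icc (0:ℝ) 1, 0 ≤ s * a s * χ' s := fun s hs =>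
    mul_nonneg (mul_nonneg hs.1 (ha_nonneg s hs)) (hpos s).le
  have hone : ∀ s ∈ Icc (0:ℝ) 1, 1 ≤ χ' s := by
    intro s hs
    have hsub : Icc 0 s ⊆ Icc (0:ℝ) 1 := Icc_subset_Icc_right hs.2
    have := left_le_of_hasDerivWithinAt_nonneg hs.1 (fun t ht => (hd' t (hsub ht)).mono hsub)
      (fun t ht => hnn t (hsub ht))
    simpa [hχ'] using this
  refine ⟨fun t => ∫ x in (0:ℝ)..t, χ' x, χ', by simp, rfl, hd, hd', ?_, ?_, ?_⟩
  · intro s hs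
    have hsub : Icc 0 s ⊆ Icc (0:ℝ) 1 := Icc_subset_Icc_right hs.2
    have := left_le_of_hasDerivWithinAt_nonneg hs.1
      (fun t ht => ((hd t (hsub ht)).mono hsub).sub (hasDerivWithinAt_id t _))
      (fun t ht => sub_nonneg.2 (hone t (hsub ht)))
    simpa using this
  · intro s hs
    have hsub : Icc 0 s ⊆ Icc (0:ℝ) 1 := Icc_subset_Icc_right hs.2
    have := left_le_of_hasDerivWithinAt_nonneg hs.1
      (fun t ht => ((hasDerivWithinAt_id t _).mul ((hd' t (hsub ht)).mono hsub)).sub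
        ((hd t (hsub ht)).mono hsub))
      (fun t ht => by
        have := mul_nonneg ht.1 (hnn t (hsub ht))
        simpa using this)
    simpa using this
  · intro s hs
    have hsub : Icc s 1 ⊆ Icc (0:ℝ) 1 := Icc_subset_Icc_left hs.1
    exact left_le_of_hasDerivWithinAt_nonneg hs.2 (fun t ht => (hd' t (hsub ht)).mono hsub)
      (fun t ht => hnn t (hsub ht))

/-- The Wronskian of a nonnegative solution with a supersolution is at most `-∫₀ᵇ σ h`. -/
theorem wronskian_le {a h τ τ' χ χ' : ℝ → ℝ} {b : ℝ} (hb : b ∈ Icc (0:ℝ) 1)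
    (ha_nonneg : ∀ s ∈ Icc (0:ℝ) 1, 0 ≤ a s)
    (hh_cont : ContinuousOn h (Icc 0 1))
    (hh_nonneg : ∀ s ∈ Icc (0:ℝ) 1, 0 ≤ h s)
    (hτ : ∀ s ∈ Icc (0:ℝ) 1, HasDerivWithinAt τ (τ' s) (Icc 0 1) s)
    (hτ' : ∀ s ∈ Icc (0:ℝ) 1, HasDerivWithinAt τ' (a s * τ s - h s) (Icc 0 1) s)
    (hτ0 : τ 0 = 0) (hχ0 : χ 0 = 0)
    (hχ : ∀ s ∈ Icc (0:ℝ) 1, HasDerivWithinAt χ (χ' s) (Icc 0 1) s)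
    (hχ' : ∀ s ∈ Icc (0:ℝ) 1, HasDerivWithinAt χ' (s * a s * χ' s) (Icc 0 1) s)
    (hle : ∀ s ∈ Icc (0:ℝ) 1, s ≤ χ s) (hge : ∀ s ∈ Icc (0:ℝ) 1, χ s ≤ s * χ' s)
    (hnn : ∀ s ∈ Icc 0 b, 0 ≤ τ s) :
    τ' b * χ b - τ b * χ' b ≤ -∫ σ in (0:ℝ)..b, σ * h σ := by
  have hsub : Icc 0 b ⊆ Icc (0:ℝ) 1 := Icc_subset_Icc_right hb.2
  have := le_left_of_hasDerivWithinAt_nonpos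
    (f := fun t => τ' t * χ t - τ t * χ' t + ∫ σ in (0:ℝ)..t, σ * h σ) hb.1
    (fun t ht => ((((hτ' t (hsub ht)).mul (hχ t (hsub ht))).sub
      ((hτ t (hsub ht)).mul (hχ' t (hsub ht)))).add
      (hasDerivWithinAt_integral_of_continuousOn (f := fun σ => σ * h σ)
        (continuousOn_id.mul hh_cont) (hsub ht))).mono hsub)
    (fun t ht => by
      have h1 := mul_nonneg (sub_nonneg.2 (hle t (hsub ht))) (hh_nonneg t (hsub ht))
      have h2 := mul_nonneg (mul_nonneg (ha_nonneg t (hsub ht)) (hnn t ht))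
        (sub_nonneg.2 (hge t (hsub ht)))
      nlinarith)
  simp only [hτ0, hχ0, intervalIntegral.integral_same] at this
  linarith

/-- Nonnegativity of the solution of `-τ'' + a τ = h`, `τ 0 = 0`, when the slope at `1` is not too
negative. -/
theorem bvp_nonneg {a h τ τ' χ χ' : ℝ → ℝ}
    (ha_nonneg : ∀ s ∈ Icc (0:ℝ) 1, 0 ≤ a s)
    (hh_cont : ContinuousOn h (Icc 0 1))
    (hh_nonneg : ∀ s ∈ Icc (0:ℝ) 1, 0 ≤ h s)
    (hτ : ∀ s ∈ Icc (0:ℝ) 1, HasDerivWithinAt τ (τ' s) (Icc 0 1) s)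
    (hτ' : ∀ s ∈ Icc (0:ℝ) 1, HasDerivWithinAt τ' (a s * τ s - h s) (Icc 0 1) s)
    (hτ0 : τ 0 = 0) (hχ0 : χ 0 = 0)
    (hχ : ∀ s ∈ Icc (0:ℝ) 1, HasDerivWithinAt χ (χ' s) (Icc 0 1) s)
    (hχ' : ∀ s ∈ Icc (0:ℝ) 1, HasDerivWithinAt χ' (s * a s * χ' s) (Icc 0 1) s)
    (hle : ∀ s ∈ Icc (0:ℝ) 1, s ≤ χ s) (hge : ∀ s ∈ Icc (0:ℝ) 1, χ s ≤ s * χ' s)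
    {E : ℝ} (hE0 : 0 ≤ E) (hE1 : E ≤ 1) (hE : ∀ s ∈ Icc (0:ℝ) 1, E * χ s ≤ s)
    (hc : 0 ≤ τ' 1 + (∫ σ in (0:ℝ)..1, σ * h σ) * E) :
    ∀ s ∈ Icc (0:ℝ) 1, 0 ≤ τ s := by
  have hcont : ContinuousOn τ (Icc 0 1) := fun s hs => (hτ s hs).continuousWithinAt
  have hmax : ∀ b ∈ Icc (0:ℝ) 1, 0 ≤ τ b → ∀ s ∈ Icc 0 b, 0 ≤ τ s := by
    intro b hb hτb
    have hsub : Icc 0 b ⊆ Icc (0:ℝ) 1 := Icc_subset_Icc_right hb.2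
    refine nonneg_of_deriv_nonpos_of_nonpos (fun s hs => (hτ s (hsub hs)).mono hsub)
      (fun s hs => (hτ' s (hsub hs)).mono hsub) (fun s hs hs0 => ?_) hτ0.ge hτb
    have := mul_nonpos_of_nonneg_of_nonpos (ha_nonneg s (hsub hs)) hs0
    linarith [hh_nonneg s (hsub hs)]
  refine hmax 1 (by simp) ?_
  by_contra! hneg
  have hclosed : IsClosed (Icc (0:ℝ) 1 ∩ τ ⁻¹' Ici 0) :=
    hcont.preimage_isClosed_of_isClosed isClosed_Icc isClosed_Ici
  obtain ⟨b, ⟨hb, hτb⟩, hbmax⟩ :=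
    (isCompact_Icc.of_isClosed_subset hclosed inter_subset_left).exists_isGreatest
      ⟨0, by simp, hτ0.ge⟩
  simp only [mem_preimage, mem_Ici] at hτb
  have hb1 : b < 1 := lt_of_le_of_ne hb.2 (by rintro rfl; linarith)
  have hlater : ∀ s ∈ Ioc b 1, τ s < 0 := by
    intro s hs
    by_contra! hs0
    exact absurd (hbmax ⟨⟨hb.1.trans hs.1.le, hs.2⟩, hs0⟩) (not_le.2 hs.1)
  have hsub : Icc b 1 ⊆ Icc (0:ℝ) 1 := Icc_subset_Icc_left hb.1
  have hτb0 : τ b = 0 := by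
    obtain ⟨z, hz, hz0⟩ := intermediate_value_Icc' hb1.le (hcont.mono hsub) ⟨hneg.le, hτb⟩
    rcases hz.1.eq_or_lt with rfl | hlt
    · exact hz0
    · exact absurd hz0 (hlater z ⟨hlt, hz.2⟩).ne
  have hW := wronskian_le hb ha_nonneg hh_cont hh_nonneg hτ hτ' hτ0 hχ0 hχ hχ' hle hge
    (hmax b hb hτb)
  have hH := fun s (hs : s ∈ Icc (0:ℝ) 1) =>
    hasDerivWithinAt_integral_of_continuousOn (f := fun σ => σ * h σ)
      (continuousOn_id.mul hh_cont) hs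
  have hHmono := left_le_of_hasDerivWithinAt_nonneg hb1.le
    (fun t ht => (hH t (hsub ht)).mono hsub)
    (fun t ht => mul_nonneg (hsub ht).1 (hh_nonneg t (hsub ht)))
  have hHb : 0 ≤ ∫ σ in (0:ℝ)..b, σ * h σ :=
    intervalIntegral.integral_nonneg hb.1 fun t ht =>
      mul_nonneg ht.1 (hh_nonneg t ⟨ht.1, ht.2.trans hb.2⟩)
  have hp := le_left_of_hasDerivWithinAt_nonpos
    (f := fun t => t * τ' t - τ t + ∫ σ in (0:ℝ)..t, σ * h σ) hb1.le
    (fun t ht => ((((hasDerivWithinAt_id t _).mul (hτ' t (hsub ht))).sub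
      (hτ t (hsub ht))).add (hH t (hsub ht))).mono hsub)
    (fun t ht => by
      have hτt : τ t ≤ 0 := by
        rcases ht.1.eq_or_lt with rfl | hlt
        · exact hτb0.le
        · exact (hlater t ⟨hlt, ht.2⟩).le
      have := mul_nonpos_of_nonneg_of_nonpos
        (mul_nonneg (hsub ht).1 (ha_nonneg t (hsub ht))) hτt
      simp only [id]
      linarith)
  have hslope : b * τ' b ≤ -(E * ∫ σ in (0:ℝ)..b, σ * h σ) := by
    rcases hb.1.eq_or_lt with rfl | hbpos
    · simp
    · rw [hτb0, zero_mul, sub_zero] at hW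
      have hχb : 0 < χ b := hbpos.trans_le (hle b hb)
      have hτ'b : τ' b ≤ 0 := by
        by_contra! hpos
        linarith [mul_pos hpos hχb]
      nlinarith [mul_le_mul_of_nonneg_left hW hE0,
        mul_nonneg_of_nonpos_of_nonpos hτ'b (sub_nonpos.2 (hE b hb))]
  have hrest := mul_nonneg (sub_nonneg.2 hE1) (sub_nonneg.2 hHmono)
  rw [hτb0] at hp
  nlinarith

/-- Two-sided bound for the solution of the tension BVP `-τ'' + a τ = h`,
`τ(0)=0`, `τ'(1)=c` with nonnegative data:
`s(c + ∫₀¹σh e^{-∫₀¹σa}) e^{-∫₀¹σa} ≤ τ(s) ≤ s(c + ∫₀¹ h)`. -/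
theorem stmt_11 (a h : ℝ → ℝ) (c : ℝ)
    (ha_cont : ContinuousOn a (Set.Icc 0 1))
    (ha_nonneg : ∀ s ∈ Set.Icc (0:ℝ) 1, 0 ≤ a s)
    (hh_cont : ContinuousOn h (Set.Icc 0 1))
    (hh_nonneg : ∀ s ∈ Set.Icc (0:ℝ) 1, 0 ≤ h s)
    (hc : 0 ≤ c + (∫ σ in (0:ℝ)..1, σ * h σ) * Real.exp (-∫ σ in (0:ℝ)..1, σ * a σ))
    (τ τ' : ℝ → ℝ)
    (hτ : ∀ s ∈ Set.Icc (0:ℝ) 1, HasDerivWithinAt τ (τ' s) (Set.Icc 0 1) s)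
    (hτ' : ∀ s ∈ Set.Icc (0:ℝ) 1, HasDerivWithinAt τ' (a s * τ s - h s) (Set.Icc 0 1) s)
    (hτ0 : τ 0 = 0) (hτ'1 : τ' 1 = c) :
    ∀ s ∈ Set.Icc (0:ℝ) 1,
      s * (c + (∫ σ in (0:ℝ)..1, σ * h σ) * Real.exp (-∫ σ in (0:ℝ)..1, σ * a σ)) *
          Real.exp (-∫ σ in (0:ℝ)..1, σ * a σ) ≤ τ s ∧
      τ s ≤ s * (c + ∫ σ in (0:ℝ)..1, h σ) := by
  obtain ⟨χ, χ', hχ0, hχ'1, hχ, hχ', hle, hge, hmono⟩ := exists_supersolution ha_cont ha_nonneg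
  have hone : (1:ℝ) ∈ Icc (0:ℝ) 1 := by simp
  have hA : 0 ≤ ∫ σ in (0:ℝ)..1, σ * a σ :=
    intervalIntegral.integral_nonneg zero_le_one fun t ht => mul_nonneg ht.1 (ha_nonneg t ht)
  have hE0 := Real.exp_pos (-∫ σ in (0:ℝ)..1, σ * a σ)
  have hE1 : Real.exp (-∫ σ in (0:ℝ)..1, σ * a σ) ≤ 1 := Real.exp_le_one_iff.2 (by linarith)
  have hEχ : Real.exp (-∫ σ in (0:ℝ)..1, σ * a σ) * χ' 1 = 1 := by
    rw [hχ'1, ← Real.exp_add, neg_add_cancel, Real.exp_zero]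
  have hH0 : 0 ≤ ∫ σ in (0:ℝ)..1, σ * h σ :=
    intervalIntegral.integral_nonneg zero_le_one fun t ht => mul_nonneg ht.1 (hh_nonneg t ht)
  set E := Real.exp (-∫ σ in (0:ℝ)..1, σ * a σ)
  set H := ∫ σ in (0:ℝ)..1, σ * h σ with hH
  have hE : ∀ s ∈ Icc (0:ℝ) 1, E * χ s ≤ s := fun s hs =>
    calc E * χ s ≤ E * (s * χ' 1) := mul_le_mul_of_nonneg_left
          ((hge s hs).trans (mul_le_mul_of_nonneg_left (hmono s hs) hs.1)) hE0.le
      _ = s * (E * χ' 1) := by ring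
      _ = s := by rw [hEχ, mul_one]
  have hnn : ∀ s ∈ Icc (0:ℝ) 1, 0 ≤ τ s :=
    bvp_nonneg ha_nonneg hh_cont hh_nonneg hτ hτ' hτ0 hχ0 hχ hχ' hle hge hE0.le hE1 hE
      (by rwa [hτ'1])
  have hW : ∀ b ∈ Icc (0:ℝ) 1, τ' b * χ b - τ b * χ' b ≤ -∫ σ in (0:ℝ)..b, σ * h σ :=
    fun b hb => wronskian_le hb ha_nonneg hh_cont hh_nonneg hτ hτ' hτ0 hχ0 hχ hχ' hle hge
      fun t ht => hnn t ⟨ht.1, ht.2.trans hb.2⟩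
  intro s hs
  constructor
  · rcases hs.1.eq_or_lt with rfl | hspos
    · simp [hτ0]
    have hsub : Icc s 1 ⊆ Icc (0:ℝ) 1 := Icc_subset_Icc_left hs.1
    have hχpos : ∀ t ∈ Icc s 1, 0 < χ t := fun t ht =>
      (hspos.trans_le ht.1).trans_le (hle t (hsub ht))
    have hχs := hχpos s ⟨le_rfl, hs.2⟩
    have hχ1 := hχpos 1 ⟨hs.2, le_rfl⟩
    have hquot : τ 1 / χ 1 ≤ τ s / χ s :=
      le_left_of_hasDerivWithinAt_nonpos (f := fun t => τ t / χ t) hs.2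
        (fun t ht => ((hτ t (hsub ht)).div (hχ t (hsub ht)) (hχpos t ht).ne').mono hsub)
        (fun t ht => by
          have hint : 0 ≤ ∫ σ in (0:ℝ)..t, σ * h σ :=
            intervalIntegral.integral_nonneg (hsub ht).1 fun x hx =>
              mul_nonneg hx.1 (hh_nonneg x ⟨hx.1, hx.2.trans ht.2⟩)
          exact div_nonpos_of_nonpos_of_nonneg (by linarith [hW t (hsub ht)]) (sq_nonneg _))
    rw [div_le_div_iff₀ hχ1 hχs] at hquot
    have hτ1 : E * (c * χ 1 + H) ≤ τ 1 := by
      have := hW 1 hone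
      rw [hτ'1, ← hH] at this
      calc E * (c * χ 1 + H) ≤ E * (τ 1 * χ' 1) :=
            mul_le_mul_of_nonneg_left (by linarith) hE0.le
        _ = τ 1 * (E * χ' 1) := by ring
        _ = τ 1 := by rw [hEχ, mul_one]
    refine le_of_mul_le_mul_right ?_ hχ1
    calc s * (c + H * E) * E * χ 1 ≤ χ s * (c + H * E) * E * χ 1 := by
          gcongr
          exact hle s hs
      _ = χ s * E * (c * χ 1 + H * (E * χ 1)) := by ring
      _ ≤ χ s * E * (c * χ 1 + H * 1) := by
          gcongr
          exact hE 1 hone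
      _ = E * (c * χ 1 + H) * χ s := by ring
      _ ≤ τ 1 * χ s := by gcongr
      _ ≤ τ s * χ 1 := hquot
  · have hslope : ∀ t ∈ Icc (0:ℝ) 1, τ' t ≤ c + ∫ σ in (0:ℝ)..1, h σ := by
      intro t ht
      have hsub : Icc t 1 ⊆ Icc (0:ℝ) 1 := Icc_subset_Icc_left ht.1
      have := left_le_of_hasDerivWithinAt_nonneg
        (f := fun x => τ' x + ∫ σ in (0:ℝ)..x, h σ) ht.2
        (fun x hx => ((hτ' x (hsub hx)).add
          (hasDerivWithinAt_integral_of_continuousOn hh_cont (hsub hx))).mono hsub)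
        (fun x hx => by linarith [mul_nonneg (ha_nonneg x (hsub hx)) (hnn x (hsub hx))])
      have hint : 0 ≤ ∫ σ in (0:ℝ)..t, h σ :=
        intervalIntegral.integral_nonneg ht.1 fun x hx => hh_nonneg x ⟨hx.1, hx.2.trans ht.2⟩
      rw [hτ'1] at this
      linarith
    have hsub : Icc 0 s ⊆ Icc (0:ℝ) 1 := Icc_subset_Icc_right hs.2
    have := le_left_of_hasDerivWithinAt_nonpos
      (f := fun t => τ t - t * (c + ∫ σ in (0:ℝ)..1, h σ)) hs.1
      (fun t ht => ((hτ t (hsub ht)).sub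
        ((hasDerivWithinAt_id t _).mul_const (c + ∫ σ in (0:ℝ)..1, h σ))).mono hsub)
      (fun t ht => by linarith [hslope t (hsub ht)])
    rw [hτ0, zero_mul, sub_zero] at this
    linarith
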